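/- Let ρ0∈L¹(0,1) and u∈L¹(0,T) be nonnegative a.e., let ξ∈C¹([0,δ]) be strictly increasing with ξ(0)=0, ξ(δ)≤1 and ξ'(t)=λ(∫₀ᵗ u(σ)dσ + ∫₀^{1−ξ(t)} ρ0(x)dx) for all t∈[0,δ], and define ρ(t,x):=ρ0(x−ξ(t)) for 0≤ξ(t)≤x≤1 and ρ(t,x):=u(ξ^{-1}(ξ(t)−x))/ξ'(ξ^{-1}(ξ(t)−x)) for 0≤x≤ξ(t)≤1. Then for every δ'∈[0,δ] and every φ∈C¹([0,δ']×[0,1]) with φ(δ',x)=0 for all x and φ(t,1)=0 for all t, one has ∫₀^{δ'}∫₀¹ ρ(t,x)(φ_t(t,x)+λ(W(t))φ_x(t,x))dx dt = −∫₀^{δ'} u(σ)φ(σ,0)dσ − ∫₀¹ ρ0(y)φ(0,y)dy, where W(t)=∫₀¹ρ(t,x)dx; that is, ρ is a weak solution of the Cauchy problem on [0,δ]. -/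

import Mathlib

open MeasureTheory Set intervalIntegral

noncomputable section

/-- The function transported along the characteristic curve `x = ξ(t)`:
`ρ(t,x) = ρ₀(x - ξ(t))` for `x ≥ ξ(t)`, and
`ρ(t,x) = u(ξ⁻¹(ξ(t)-x)) / ξ'(ξ⁻¹(ξ(t)-x))` for `x ≤ ξ(t)`. -/
def transportSol (ρ₀ u ξ dξ ξinv : ℝ → ℝ) (t x : ℝ) : ℝ :=
  if ξ t ≤ x then ρ₀ (x - ξ t) else u (ξinv (ξ t - x)) / dξ (ξinv (ξ t - x))

/-- The primitive of an integrable function is continuous, as an interval integral. -/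
lemma continuousOn_primitive_Icc_of_integrableOn {f : ℝ → ℝ} {a b : ℝ} (hab : a ≤ b)
    (hf : IntegrableOn f (Ioc a b)) : ContinuousOn (fun t => ∫ s in a..t, f s) (Icc a b) := by
  have hf' : IntegrableOn f (uIcc a b) := by
    rwa [uIcc_of_le hab, integrableOn_Icc_iff_integrableOn_Ioc]
  simpa only [uIcc_of_le hab] using continuousOn_primitive_interval hf'

/-- The derivative of a `C¹` function of two variables in the direction `(1, a)`. -/
lemma deriv_add_mul_deriv_eq_fderiv {φ : ℝ → ℝ → ℝ} (hφ : ContDiff ℝ 1 (Function.uncurry φ))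
    (t x a : ℝ) :
    deriv (fun s => φ s x) t + a * deriv (φ t) x
      = fderiv ℝ (Function.uncurry φ) (t, x) (1, a) := by
  have hd : HasFDerivAt (Function.uncurry φ) (fderiv ℝ (Function.uncurry φ) (t, x)) (t, x) :=
    (hφ.differentiable one_ne_zero (t, x)).hasFDerivAt
  have h1 : HasDerivAt (fun s => φ s x) (fderiv ℝ (Function.uncurry φ) (t, x) (1, 0)) t :=
    hd.comp_hasDerivAt (f := fun s => (s, x)) t
      ((hasDerivAt_id t).prodMk (hasDerivAt_const t x))
  have h2 : HasDerivAt (φ t) (fderiv ℝ (Function.uncurry φ) (t, x) (0, 1)) x :=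
    hd.comp_hasDerivAt x ((hasDerivAt_const x t).prodMk (hasDerivAt_id x))
  have h3 : ((1, a) : ℝ × ℝ) = (1, 0) + a • (0, 1) := by simp
  rw [h1.deriv, h2.deriv, h3, map_add, map_smul, smul_eq_mul]

/-- The fundamental theorem of calculus along a translate of the curve `x = X(t)`. -/
lemma integral_fderiv_along_curve {φ : ℝ → ℝ → ℝ} (hφ : ContDiff ℝ 1 (Function.uncurry φ))
    {X d : ℝ → ℝ} (hX : Continuous X) (hd : Continuous d) {a b : ℝ} (hab : a ≤ b)
    (hXd : ∀ t ∈ Ioo a b, HasDerivAt X (d t) t) (c : ℝ) :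
    ∫ t in Ioc a b, fderiv ℝ (Function.uncurry φ) (t, c + X t) (1, d t)
      = φ b (c + X b) - φ a (c + X a) := by
  have hcont : Continuous fun t => fderiv ℝ (Function.uncurry φ) (t, c + X t) (1, d t) :=
    ((hφ.continuous_fderiv one_ne_zero).comp (by fun_prop)).clm_apply (by fun_prop)
  have hφX : Continuous fun t => φ t (c + X t) :=
    hφ.continuous.comp (continuous_id.prodMk (continuous_const.add hX))
  rw [← intervalIntegral.integral_of_le hab]
  refine integral_eq_sub_of_hasDerivAt_of_le hab (f := fun t => φ t (c + X t))
    hφX.continuousOn (fun t ht => ?_) (hcont.intervalIntegrable _ _)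
  exact (hφ.differentiable one_ne_zero (t, c + X t)).hasFDerivAt.comp_hasDerivAt t
    ((hasDerivAt_id t).prodMk ((hXd t ht).const_add c))

/-- An `L¹` function of the second variable times a truncated continuous kernel is integrable on
a rectangle. -/
lemma integrable_mul_indicator_prod {f : ℝ → ℝ} {a b : ℝ} (hf : IntegrableOn f (Ioc 0 b))
    {K : ℝ × ℝ → ℝ} (hK : Continuous K) {S : Set (ℝ × ℝ)} (hS : MeasurableSet S) :
    Integrable (fun p : ℝ × ℝ => f p.2 * S.indicator K p)
      ((volume.restrict (Ioc 0 a)).prod (volume.restrict (Ioc 0 b))) := by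
  obtain ⟨C, hC⟩ := (isCompact_Icc.prod isCompact_Icc).exists_bound_of_continuousOn
    (s := Icc (0 : ℝ) a ×ˢ Icc (0 : ℝ) b) hK.continuousOn
  refine Integrable.mul_bdd (c := C) (Integrable.comp_snd hf _)
    (hK.measurable.indicator hS).aestronglyMeasurable ?_
  rw [Measure.prod_restrict]
  refine (ae_restrict_iff' (measurableSet_Ioc.prod measurableSet_Ioc)).2
    (Filter.Eventually.of_forall fun p hp => ?_)
  exact (norm_indicator_le_norm_self _ _).trans
    (hC p ⟨Ioc_subset_Icc_self hp.1, Ioc_subset_Icc_self hp.2⟩)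

/-- Integrating the transported function against a continuous function: the mass carried by
`x ≥ ξ(t)` comes from the initial datum, the mass carried by `x ≤ ξ(t)` from the inflow. -/
lemma integral_transportSol_mul {ρ₀ u ξ dξ ξinv : ℝ → ℝ} {t : ℝ}
    (hρ₀ : IntegrableOn ρ₀ (Ioc 0 1)) (ht : 0 ≤ t) (hu : IntegrableOn u (Ioc 0 t))
    (hξ0 : ξ 0 = 0) (hξt : ξ t ≤ 1) (hmono : StrictMonoOn ξ (Icc 0 t))
    (hpos : ∀ s ∈ Icc 0 t, 0 < dξ s)
    (hderiv : ∀ s ∈ Icc 0 t, HasDerivWithinAt ξ (dξ s) (Icc 0 t) s)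
    (hinv : ∀ s ∈ Icc 0 t, ξinv (ξ s) = s) {ψ : ℝ → ℝ} (hψ : Continuous ψ) :
    ∫ x in Ioc (0 : ℝ) 1, transportSol ρ₀ u ξ dξ ξinv t x * ψ x
      = (∫ y in Ioc 0 (1 - ξ t), ρ₀ y * ψ (y + ξ t))
        + ∫ σ in Ioc 0 t, u σ * ψ (ξ t - ξ σ) := by
  have h0 : (0 : ℝ) ∈ Icc 0 t := left_mem_Icc.2 ht
  have htt : t ∈ Icc 0 t := right_mem_Icc.2 ht
  have hξt0 : 0 ≤ ξ t := hξ0 ▸ hmono.monotoneOn h0 htt ht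
  have hξc : ContinuousOn ξ (Icc 0 t) := fun s hs => (hderiv s hs).continuousWithinAt
  have himage : ξ '' Icc 0 t = Icc 0 (ξ t) := by
    have hsurj := intermediate_value_Icc ht hξc
    rw [hξ0] at hsurj
    refine Subset.antisymm ?_ hsurj
    rintro _ ⟨s, hs, rfl⟩
    exact ⟨hξ0 ▸ hmono.monotoneOn h0 hs hs.1, hmono.monotoneOn hs htt hs.2⟩
  set r : ℝ → ℝ := fun y => ρ₀ y * ψ (y + ξ t) with hr
  set h : ℝ → ℝ := fun y => u (ξinv y) / dξ (ξinv y) * ψ (ξ t - y) with hh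
  have hpull : EqOn (fun σ => |dξ σ| • h (ξ σ)) (fun σ => u σ * ψ (ξ t - ξ σ)) (Icc 0 t) := by
    intro σ hσ
    have := hpos σ hσ
    simp only [hh, hinv σ hσ, smul_eq_mul, abs_of_pos this]
    field_simp
  have huI : IntegrableOn (fun σ => u σ * ψ (ξ t - ξ σ)) (Icc 0 t) :=
    ((integrableOn_Icc_iff_integrableOn_Ioc (μ := volume)).2 hu).mul_continuousOn
      (hψ.comp_continuousOn (continuousOn_const.sub hξc)) isCompact_Icc
  have hhI : IntegrableOn h (Icc 0 (ξ t)) := by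
    rw [← himage, integrableOn_image_iff_integrableOn_abs_deriv_smul measurableSet_Icc hderiv
      hmono.injOn]
    exact huI.congr_fun hpull.symm measurableSet_Icc
  have hhint : ∫ y in (0 : ℝ)..ξ t, h y = ∫ σ in Ioc 0 t, u σ * ψ (ξ t - ξ σ) := by
    rw [intervalIntegral.integral_of_le hξt0, ← integral_Icc_eq_integral_Ioc, ← himage,
      integral_image_eq_integral_abs_deriv_smul measurableSet_Icc hderiv hmono.injOn,
      setIntegral_congr_fun measurableSet_Icc hpull, integral_Icc_eq_integral_Ioc]
  have hhII : IntervalIntegrable h volume 0 (ξ t) :=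
    (intervalIntegrable_iff_integrableOn_Icc_of_le hξt0).2 hhI
  have hrII : IntervalIntegrable r volume 0 (1 - ξ t) := by
    refine IntervalIntegrable.mul_continuousOn ?_ (by fun_prop)
    rw [intervalIntegrable_iff_integrableOn_Ioc_of_le (by linarith)]
    exact hρ₀.mono_set (Ioc_subset_Ioc_right (by linarith))
  have hleft : EqOn (fun x => h (ξ t - x))
      (fun x => transportSol ρ₀ u ξ dξ ξinv t x * ψ x) (Ioo 0 (ξ t)) := by
    intro x hx
    simp [hh, transportSol, not_le.2 hx.2]
  have hright : EqOn (fun x => r (x - ξ t))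
      (fun x => transportSol ρ₀ u ξ dξ ξinv t x * ψ x) (Icc (ξ t) 1) := by
    intro x hx
    simp [hr, transportSol, hx.1]
  have hlI : IntervalIntegrable (fun x => h (ξ t - x)) volume 0 (ξ t) := by
    simpa using (hhII.comp_sub_left (ξ t)).symm
  have hrI : IntervalIntegrable (fun x => r (x - ξ t)) volume (ξ t) 1 := by
    simpa using hrII.comp_sub_right (ξ t)
  have hlI' : IntervalIntegrable (fun x => transportSol ρ₀ u ξ dξ ξinv t x * ψ x)
      volume 0 (ξ t) := by
    rw [intervalIntegrable_iff_integrableOn_Ioo_of_le hξt0] at hlI ⊢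
    exact hlI.congr_fun hleft measurableSet_Ioo
  have hrI' : IntervalIntegrable (fun x => transportSol ρ₀ u ξ dξ ξinv t x * ψ x)
      volume (ξ t) 1 := by
    rw [intervalIntegrable_iff_integrableOn_Icc_of_le hξt] at hrI ⊢
    exact hrI.congr_fun hright measurableSet_Icc
  rw [← intervalIntegral.integral_of_le zero_le_one,
    ← intervalIntegral.integral_add_adjacent_intervals hlI' hrI', add_comm]
  congr 1
  · rw [intervalIntegral.integral_of_le hξt, ← integral_Icc_eq_integral_Ioc,
      ← setIntegral_congr_fun measurableSet_Icc hright, integral_Icc_eq_integral_Ioc,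
      ← intervalIntegral.integral_of_le hξt, intervalIntegral.integral_comp_sub_right r,
      sub_self, intervalIntegral.integral_of_le (by linarith)]
  · rw [← hhint, intervalIntegral.integral_of_le hξt0, integral_Ioc_eq_integral_Ioo,
      ← setIntegral_congr_fun measurableSet_Ioo hleft, ← integral_Ioc_eq_integral_Ioo,
      ← intervalIntegral.integral_of_le hξt0, intervalIntegral.integral_comp_sub_left h]
    simp

/-- Fubini's theorem for a truncated kernel, when the truncated kernel has known integrals in the
first variable. -/
lemma integral_integral_mul_indicator {f g : ℝ → ℝ} {a b : ℝ} (hf : IntegrableOn f (Ioc 0 b))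
    {K : ℝ × ℝ → ℝ} (hK : Continuous K) {S : Set (ℝ × ℝ)} (hS : MeasurableSet S)
    (hg : ∀ y ∈ Ioc 0 b, ∫ t in Ioc 0 a, S.indicator K (t, y) = g y) :
    ∫ t in Ioc 0 a, ∫ y in Ioc 0 b, f y * S.indicator K (t, y) = ∫ y in Ioc 0 b, f y * g y := by
  rw [integral_integral_swap (f := fun t y => f y * S.indicator K (t, y))
    (integrable_mul_indicator_prod hf hK hS)]
  refine setIntegral_congr_fun measurableSet_Ioc fun y hy => ?_
  simp only [MeasureTheory.integral_const_mul, hg y hy]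

/-- The transported solution is a weak solution of the Cauchy problem on `[0,δ]`:
for every `δ' ∈ [0,δ]` and every test function `φ ∈ C¹` with `φ(δ',·) = 0` and
`φ(·,1) = 0`, the weak formulation identity holds. -/
theorem transport_is_weak_solution
    (lam : ℝ → ℝ) (hlam : ContDiff ℝ 1 lam) (hlam_pos : ∀ w, 0 < lam w)
    (T : ℝ) (hT : 0 < T) (ρ₀ u : ℝ → ℝ)
    (hρ₀ : MeasureTheory.IntegrableOn ρ₀ (Set.Ioc 0 1))
    (hu : MeasureTheory.IntegrableOn u (Set.Ioc 0 T))
    (hρ₀nn : ∀ᵐ x ∂(volume.restrict (Set.Ioc (0:ℝ) 1)), 0 ≤ ρ₀ x)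
    (hunn : ∀ᵐ t ∂(volume.restrict (Set.Ioc (0:ℝ) T)), 0 ≤ u t)
    (δ : ℝ) (hδ0 : 0 < δ) (hδT : δ ≤ T)
    (ξ dξ ξinv : ℝ → ℝ)
    (hξ0 : ξ 0 = 0) (hξδ : ξ δ ≤ 1)
    (hmono : StrictMonoOn ξ (Set.Icc 0 δ))
    (hdξ : ∀ t ∈ Set.Icc (0:ℝ) δ,
        dξ t = lam ((∫ σ in (0:ℝ)..t, u σ) + ∫ x in (0:ℝ)..(1 - ξ t), ρ₀ x))
    (hderiv : ∀ t ∈ Set.Icc (0:ℝ) δ, HasDerivWithinAt ξ (dξ t) (Set.Icc 0 δ) t)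
    (hinv1 : ∀ t ∈ Set.Icc (0:ℝ) δ, ξinv (ξ t) = t)
    (hinv2 : ∀ y ∈ Set.Icc (0:ℝ) (ξ δ), ξ (ξinv y) = y ∧ ξinv y ∈ Set.Icc (0:ℝ) δ) :
    ∀ δ' ∈ Set.Icc (0:ℝ) δ, ∀ φ : ℝ → ℝ → ℝ,
      ContDiff ℝ 1 (Function.uncurry φ) →
      (∀ x ∈ Set.Icc (0:ℝ) 1, φ δ' x = 0) →
      (∀ t ∈ Set.Icc (0:ℝ) δ', φ t 1 = 0) →
      (∫ t in Set.Ioc (0:ℝ) δ', ∫ x in Set.Ioc (0:ℝ) 1,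
          transportSol ρ₀ u ξ dξ ξinv t x * (deriv (fun s => φ s x) t
            + lam (∫ y in Set.Ioc (0:ℝ) 1, transportSol ρ₀ u ξ dξ ξinv t y)
                * deriv (φ t) x))
        = -(∫ σ in Set.Ioc (0:ℝ) δ', u σ * φ σ 0)
          - ∫ y in Set.Ioc (0:ℝ) 1, ρ₀ y * φ 0 y := by
  intro δ' hδ' φ hφ hφδ hφ1
  have hsub : ∀ {t}, t ∈ Icc 0 δ → Icc 0 t ⊆ Icc 0 δ := fun ht => Icc_subset_Icc_right ht.2
  have hξ_nonneg : ∀ t ∈ Icc 0 δ, 0 ≤ ξ t := fun t ht =>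
    hξ0 ▸ hmono.monotoneOn (left_mem_Icc.2 hδ0.le) ht ht.1
  have hξ_le : ∀ t ∈ Icc 0 δ, ξ t ≤ 1 := fun t ht =>
    (hmono.monotoneOn ht (right_mem_Icc.2 hδ0.le) ht.2).trans hξδ
  have hu' : ∀ t ∈ Icc 0 δ, IntegrableOn u (Ioc 0 t) := fun t ht =>
    hu.mono_set (Ioc_subset_Ioc_right (ht.2.trans hδT))
  have hinner : ∀ t ∈ Icc 0 δ, ∀ ψ : ℝ → ℝ, Continuous ψ →
      ∫ x in Ioc (0 : ℝ) 1, transportSol ρ₀ u ξ dξ ξinv t x * ψ x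
        = (∫ y in Ioc 0 (1 - ξ t), ρ₀ y * ψ (y + ξ t))
          + ∫ σ in Ioc 0 t, u σ * ψ (ξ t - ξ σ) := fun t ht ψ hψ =>
    integral_transportSol_mul hρ₀ ht.1 (hu' t ht) hξ0 (hξ_le t ht) (hmono.mono (hsub ht))
      (fun s hs => hdξ s (hsub ht hs) ▸ hlam_pos _)
      (fun s hs => (hderiv s (hsub ht hs)).mono (hsub ht)) (fun s hs => hinv1 s (hsub ht hs)) hψ
  have hmass : ∀ t ∈ Icc 0 δ,
      lam (∫ y in Ioc (0 : ℝ) 1, transportSol ρ₀ u ξ dξ ξinv t y) = dξ t := by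
    intro t ht
    have h := hinner t ht (fun _ => 1) continuous_const
    simp only [mul_one] at h
    rw [h, hdξ t ht, intervalIntegral.integral_of_le ht.1,
      intervalIntegral.integral_of_le (sub_nonneg.2 (hξ_le t ht)), add_comm]
  have hξc : ContinuousOn ξ (Icc 0 δ) := fun t ht => (hderiv t ht).continuousWithinAt
  have hdξc : ContinuousOn dξ (Icc 0 δ) := by
    have h1 := continuousOn_primitive_Icc_of_integrableOn hδ0.le
      (hu' δ (right_mem_Icc.2 hδ0.le))
    have h2 := continuousOn_primitive_Icc_of_integrableOn zero_le_one hρ₀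
    refine (hlam.continuous.comp_continuousOn (h1.add (h2.comp (continuousOn_const.sub hξc)
      fun t ht => ⟨?_, ?_⟩))).congr hdξ
    · exact sub_nonneg.2 (hξ_le t ht)
    · exact sub_le_self _ (hξ_nonneg t ht)
  -- Globally continuous extensions of `ξ` and `dξ`, so that the kernels below are continuous.
  obtain ⟨X, hX, hXξ⟩ : ∃ X : ℝ → ℝ, Continuous X ∧ EqOn X ξ (Icc 0 δ) :=
    ⟨IccExtend hδ0.le ((Icc 0 δ).domRestrict ξ), hξc.domRestrict.Icc_extend',
      fun t ht => IccExtend_of_mem _ _ ht⟩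
  obtain ⟨d, hd, hdd⟩ : ∃ d : ℝ → ℝ, Continuous d ∧ EqOn d dξ (Icc 0 δ) :=
    ⟨IccExtend hδ0.le ((Icc 0 δ).domRestrict dξ), hdξc.domRestrict.Icc_extend',
      fun t ht => IccExtend_of_mem _ _ ht⟩
  have hXd : ∀ t ∈ Ioo 0 δ, HasDerivAt X (d t) t := fun t ht => by
    rw [hdd (Ioo_subset_Icc_self ht)]
    exact ((hderiv t (Ioo_subset_Icc_self ht)).congr hXξ (hXξ (Ioo_subset_Icc_self ht))).hasDerivAt
      (Icc_mem_nhds ht.1 ht.2)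
  set K : ℝ → ℝ → ℝ := fun t c => fderiv ℝ (Function.uncurry φ) (t, c + X t) (1, d t) with hK
  have hKint : ∀ a b c, 0 ≤ a → a ≤ b → b ≤ δ →
      ∫ t in Ioc a b, K t c = φ b (c + X b) - φ a (c + X a) := fun a b c ha hab hb =>
    integral_fderiv_along_curve hφ hX hd hab
      (fun t ht => hXd t ⟨ha.trans_lt ht.1, ht.2.trans_le hb⟩) c
  have hDφ := hφ.continuous_fderiv one_ne_zero
  have hK₁ : Continuous fun p : ℝ × ℝ => K p.1 p.2 :=
    (hDφ.comp (by fun_prop)).clm_apply (by fun_prop)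
  have hK₂ : Continuous fun p : ℝ × ℝ => K p.1 (-X p.2) :=
    hK₁.comp (continuous_fst.prodMk (hX.comp continuous_snd).neg)
  set S₁ : Set (ℝ × ℝ) := {p | p.2 ≤ 1 - X p.1} with hS₁_def
  set S₂ : Set (ℝ × ℝ) := {p | p.2 ≤ p.1} with hS₂_def
  have hS₁ : MeasurableSet S₁ :=
    (isClosed_le continuous_snd (continuous_const.sub (hX.comp continuous_fst))).measurableSet
  have hS₂ : MeasurableSet S₂ := (isClosed_le continuous_snd continuous_fst).measurableSet
  have hslice : ∀ t ∈ Ioc 0 δ',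
      ∫ x in Ioc (0 : ℝ) 1, transportSol ρ₀ u ξ dξ ξinv t x * (deriv (fun s => φ s x) t
          + lam (∫ y in Ioc (0 : ℝ) 1, transportSol ρ₀ u ξ dξ ξinv t y) * deriv (φ t) x)
        = (∫ y in Ioc (0 : ℝ) 1, ρ₀ y * S₁.indicator (fun p => K p.1 p.2) (t, y))
          + ∫ σ in Ioc 0 δ', u σ * S₂.indicator (fun p => K p.1 (-X p.2)) (t, σ) := by
    intro t ht'
    have ht : t ∈ Icc 0 δ := ⟨ht'.1.le, ht'.2.trans hδ'.2⟩
    have hψ : Continuous fun x => fderiv ℝ (Function.uncurry φ) (t, x) (1, dξ t) :=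
      (hDφ.comp (by fun_prop)).clm_apply (by fun_prop)
    simp only [hmass t ht, deriv_add_mul_deriv_eq_fderiv hφ]
    rw [hinner t ht _ hψ]
    congr 1
    · have : ∀ y, ρ₀ y * S₁.indicator (fun p => K p.1 p.2) (t, y)
          = (Iic (1 - ξ t)).indicator
            (fun y => ρ₀ y * fderiv ℝ (Function.uncurry φ) (t, y + ξ t) (1, dξ t)) y := by
        intro y
        simp [indicator_apply, hS₁_def, hK, hXξ ht, hdd ht]
      simp only [this]
      rw [setIntegral_indicator measurableSet_Iic, Ioc_inter_Iic,
        min_eq_right (sub_le_self _ (hξ_nonneg t ht))]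
    · have : EqOn (fun σ => u σ * S₂.indicator (fun p => K p.1 (-X p.2)) (t, σ))
          ((Iic t).indicator
            (fun σ => u σ * fderiv ℝ (Function.uncurry φ) (t, ξ t - ξ σ) (1, dξ t)))
          (Ioc 0 δ') := by
        intro σ hσ
        simp [indicator_apply, hS₂_def, hK, hXξ ht, hdd ht,
          hXξ (show σ ∈ Icc 0 δ from ⟨hσ.1.le, hσ.2.trans hδ'.2⟩), neg_add_eq_sub]
      rw [setIntegral_congr_fun measurableSet_Ioc this, setIntegral_indicator measurableSet_Iic,
        Ioc_inter_Iic, min_eq_right ht'.2]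
  have hinitial : ∀ y ∈ Ioc (0 : ℝ) 1,
      ∫ t in Ioc 0 δ', S₁.indicator (fun p => K p.1 p.2) (t, y) = -φ 0 y := by
    intro y hy
    obtain ⟨τ, hτ, hτmem, hτφ⟩ : ∃ τ ∈ Icc 0 δ',
        (∀ t ∈ Ioc 0 δ', y ≤ 1 - ξ t ↔ t ≤ τ) ∧ φ τ (y + ξ τ) = 0 := by
      rcases le_or_gt y (1 - ξ δ') with hyδ | hyδ
      · refine ⟨δ', right_mem_Icc.2 hδ'.1, fun t ht => ?_,
          hφδ _ ⟨add_nonneg hy.1.le (hξ_nonneg δ' hδ'), by linarith⟩⟩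
        have := hmono.monotoneOn ⟨ht.1.le, ht.2.trans hδ'.2⟩ hδ' ht.2
        exact iff_of_true (by linarith) ht.2
      · have hξδ' := hmono.monotoneOn hδ' (right_mem_Icc.2 hδ0.le) hδ'.2
        obtain ⟨hξτ, hτ⟩ := hinv2 (1 - y) ⟨by linarith [hy.2], by linarith⟩
        have hτδ : ξinv (1 - y) ≤ δ' := (hmono.le_iff_le hτ hδ').1 (by linarith)
        refine ⟨ξinv (1 - y), ⟨hτ.1, hτδ⟩, fun t ht => ?_, ?_⟩
        · rw [← hmono.le_iff_le ⟨ht.1.le, ht.2.trans hδ'.2⟩ hτ, hξτ, le_sub_comm]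
        · rw [hξτ, add_sub_cancel]
          exact hφ1 _ ⟨hτ.1, hτδ⟩
    have hcongr : EqOn (fun t => S₁.indicator (fun p => K p.1 p.2) (t, y))
        ((Iic τ).indicator fun t => K t y) (Ioc 0 δ') := by
      intro t ht
      simp [indicator_apply, hS₁_def, hXξ (show t ∈ Icc 0 δ from ⟨ht.1.le, ht.2.trans hδ'.2⟩),
        hτmem t ht]
    have hτδ : τ ∈ Icc 0 δ := ⟨hτ.1, hτ.2.trans hδ'.2⟩
    rw [setIntegral_congr_fun measurableSet_Ioc hcongr, setIntegral_indicator measurableSet_Iic,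
      Ioc_inter_Iic, min_eq_right hτ.2, hKint 0 τ y le_rfl hτ.1 hτδ.2, hXξ hτδ, hτφ,
      hXξ (left_mem_Icc.2 hδ0.le), hξ0, add_zero, zero_sub]
  have hboundary : ∀ σ ∈ Ioc 0 δ',
      ∫ t in Ioc 0 δ', S₂.indicator (fun p => K p.1 (-X p.2)) (t, σ) = -φ σ 0 := by
    intro σ hσ
    have hσδ : σ ∈ Icc 0 δ := ⟨hσ.1.le, hσ.2.trans hδ'.2⟩
    have hcongr : ∀ t, S₂.indicator (fun p => K p.1 (-X p.2)) (t, σ)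
        = (Ici σ).indicator (fun t => K t (-X σ)) t := by
      intro t
      simp [indicator_apply, hS₂_def]
    have hset : Ioc 0 δ' ∩ Ici σ = Icc σ δ' := by
      ext t
      exact ⟨fun h => ⟨h.2, h.1.2⟩, fun h => ⟨⟨hσ.1.trans_le h.1, h.2⟩, h.1⟩⟩
    have hmem : -ξ σ + ξ δ' ∈ Icc (0 : ℝ) 1 := by
      have := hmono.monotoneOn hσδ hδ' hσ.2
      exact ⟨by linarith, by linarith [hξ_nonneg σ hσδ, hξ_le δ' hδ']⟩
    simp only [hcongr]
    rw [setIntegral_indicator measurableSet_Ici, hset, integral_Icc_eq_integral_Ioc,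
      hKint σ δ' _ hσ.1.le hσ.2 hδ'.2, hXξ hσδ, hXξ hδ', hφδ _ hmem, neg_add_cancel, zero_sub]
  rw [setIntegral_congr_fun measurableSet_Ioc hslice,
    integral_add (integrable_mul_indicator_prod hρ₀ hK₁ hS₁).integral_prod_left
      (integrable_mul_indicator_prod (hu' δ' hδ') hK₂ hS₂).integral_prod_left,
    integral_integral_mul_indicator hρ₀ hK₁ hS₁ hinitial,
    integral_integral_mul_indicator (hu' δ' hδ') hK₂ hS₂ hboundary]
  simp only [mul_neg, MeasureTheory.integral_neg]
  ring
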